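/- arXiv:hep-th/0012133 — 3 statements merged into one kernel-verified Lean document; each statement's English description precedes it below -/
import Mathlib

section
/- For all complex numbers u1, u2, u3, u4, the commutative bilinear product * on the 4-dimensional complex vector space with basis e1, e2, e3, e4 defined by the F4 multiplication table is associative: (v*w)*z = v*(w*z) for all vectors v, w, z. -/
open Finset

/-- The F4 multiplication table: the coefficient of `e_k` in `e_i * e_j`,
as read off from the structure constants of the algebra of holomorphic
differential forms for pure F4 N=2 Super-Yang-Mills theory. -/
noncomputable def F4mulTable (u1 u2 u3 u4 : ℂ) : Fin 4 → Fin 4 → Fin 4 → ℂ :=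
  let c11 : Fin 4 → ℂ := ![
    (250/243)*u1^5 - (10/9)*u1^2*u2 - (7/3)*u1*u3,
    (100/81)*u1^4*u2 + (140/27)*u1^3*u3 - (2/3)*u1*u2^2 - (4/3)*u1*u4 - 2*u2*u3,
    (100/243)*u1^4*u3 - (2/9)*u1*u2*u3 - (2/3)*u3^2 - (10/27)*u1^2*u4,
    (50/81)*u1^4*u4 + (10/9)*u1^2*u3^2 - (1/3)*u1*u2*u4 - u3*u4]
  let c12 : Fin 4 → ℂ := ![
    -(25/54)*u1^3 + (1/4)*u2,
    -(5/9)*u1^2*u2 - (7/3)*u1*u3,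
    (1/6)*u4 - (5/27)*u1^2*u3,
    -(1/2)*u3^2 - (5/18)*u1^2*u4]
  let c13 : Fin 4 → ℂ := ![-(5/3)*u1^2, -2*u1*u2 - 6*u3, -(2/3)*u1*u3, -u1*u4]
  let c22 : Fin 4 → ℂ := ![(5/24)*u1, (1/4)*u2, (1/12)*u3, (1/8)*u4]
  let c23 : Fin 4 → ℂ := ![3/4, 0, 0, 0]
  let c33 : Fin 4 → ℂ := ![0, -6*u1, 0, -(9/2)*u3]
  let e1 : Fin 4 → ℂ := ![1, 0, 0, 0]
  let e2 : Fin 4 → ℂ := ![0, 1, 0, 0]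
  let e3 : Fin 4 → ℂ := ![0, 0, 1, 0]
  let e4 : Fin 4 → ℂ := ![0, 0, 0, 1]
  ![![c11, c12, c13, e1],
    ![c12, c22, c23, e2],
    ![c13, c23, c33, e3],
    ![e1, e2, e3, e4]]

/-- The commutative bilinear product on `ℂ^4` determined by the F4 table. -/
noncomputable def F4mul (u1 u2 u3 u4 : ℂ) (v w : Fin 4 → ℂ) : Fin 4 → ℂ :=
  fun k => ∑ i : Fin 4, ∑ j : Fin 4, v i * w j * F4mulTable u1 u2 u3 u4 i j k

set_option maxHeartbeats 4000000 in
theorem F4mulTable_assoc (u1 u2 u3 u4 : ℂ) (i j k m : Fin 4) :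
    ∑ l, F4mulTable u1 u2 u3 u4 i j l * F4mulTable u1 u2 u3 u4 l k m
      = ∑ l, F4mulTable u1 u2 u3 u4 j k l * F4mulTable u1 u2 u3 u4 i l m := by
  fin_cases i <;> fin_cases j <;> fin_cases k <;> fin_cases m <;>
    simp [F4mulTable, Fin.sum_univ_four] <;> ring

/-- Theorem 1 of the paper: the F4 algebra of holomorphic forms is associative. -/
theorem F4_algebra_associative (u1 u2 u3 u4 : ℂ) (v w z : Fin 4 → ℂ) :
    F4mul u1 u2 u3 u4 (F4mul u1 u2 u3 u4 v w) z
      = F4mul u1 u2 u3 u4 v (F4mul u1 u2 u3 u4 w z) := by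
  funext m
  have sum_left : F4mul u1 u2 u3 u4 (F4mul u1 u2 u3 u4 v w) z m
      = ∑ i, ∑ j, ∑ k, v i * w j * z k *
        ∑ l, F4mulTable u1 u2 u3 u4 i j l * F4mulTable u1 u2 u3 u4 l k m := by
    simp only [F4mul, Fin.sum_univ_four]
    ring
  have sum_right : F4mul u1 u2 u3 u4 v (F4mul u1 u2 u3 u4 w z) m
      = ∑ i, ∑ j, ∑ k, v i * w j * z k *
        ∑ l, F4mulTable u1 u2 u3 u4 j k l * F4mulTable u1 u2 u3 u4 i l m := by
    simp only [F4mul, Fin.sum_univ_four]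
    ring
  simp only [sum_left, sum_right, F4mulTable_assoc]
end

section
/- Let R be a commutative ring in which 2 is invertible, let p, q be elements of R, and let S = R[A,B,C]/I be the quotient of the polynomial ring R[A,B,C] by the ideal I generated by C^2 - q^2 - 4p^3, AB + p^3, A^2 - (q - C)B/2, B^2 - (q + C)A/2. Then S is generated as an R-module by the images of the six elements 1, A, B, C, AC, BC; i.e., every element of S can be written as r1 + r2·A + r3·B + r4·C + r5·AC + r6·BC with r1,...,r6 in R. -/
open MvPolynomial

/-- If `x 0, x 1, x 2` satisfy the four relations in an `R`-algebra, then every polynomial in them is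
an `R`-linear combination of `1, x 0, x 1, x 2, x 0 * x 2, x 1 * x 2`. -/
theorem exists_aeval_eq_six_generators {R S : Type*} [CommRing R] [CommRing S] [Algebra R S]
    {p q h : R} {x : Fin 3 → S}
    (hcc : x 2 ^ 2 = algebraMap R S q ^ 2 + 4 * algebraMap R S p ^ 3)
    (hab : x 0 * x 1 = -algebraMap R S p ^ 3)
    (haa : x 0 ^ 2 = (algebraMap R S q - x 2) * x 1 * algebraMap R S h)
    (hbb : x 1 ^ 2 = (algebraMap R S q + x 2) * x 0 * algebraMap R S h)
    (f : MvPolynomial (Fin 3) R) :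
    ∃ r1 r2 r3 r4 r5 r6 : R, aeval x f =
      algebraMap R S r1 + algebraMap R S r2 * x 0 + algebraMap R S r3 * x 1
        + algebraMap R S r4 * x 2 + algebraMap R S r5 * (x 0 * x 2)
        + algebraMap R S r6 * (x 1 * x 2) := by
  induction f using MvPolynomial.induction_on with
  | C r => exact ⟨r, 0, 0, 0, 0, 0, by simp⟩
  | add f g hf hg =>
    obtain ⟨r1, r2, r3, r4, r5, r6, hr⟩ := hf
    obtain ⟨s1, s2, s3, s4, s5, s6, hs⟩ := hg
    refine ⟨r1 + s1, r2 + s2, r3 + s3, r4 + s4, r5 + s5, r6 + s6, ?_⟩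
    simp only [map_add, hr, hs]
    ring
  | mul_X f i hf =>
    obtain ⟨r1, r2, r3, r4, r5, r6, hr⟩ := hf
    rw [map_mul, aeval_X, hr]
    set φ := algebraMap R S
    fin_cases i
    · refine ⟨-(r3 * p ^ 3), r1, r2 * q * h - r5 * h * (q ^ 2 + 4 * p ^ 3), -(r6 * p ^ 3), r4,
        r5 * q * h - r2 * h, ?_⟩
      simp only [map_add, map_sub, map_neg, map_mul, map_pow, map_ofNat, Fin.zero_eta]
      linear_combination (φ r2 + φ r5 * x 2) * haa + (φ r3 + φ r6 * x 2) * hab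
        - φ r5 * φ h * x 1 * hcc
    · refine ⟨-(r2 * p ^ 3), r3 * q * h + r6 * h * (q ^ 2 + 4 * p ^ 3), r1, -(r5 * p ^ 3),
        r6 * q * h + r3 * h, r4, ?_⟩
      simp only [map_add, map_neg, map_mul, map_pow, map_ofNat, Fin.mk_one]
      linear_combination (φ r3 + φ r6 * x 2) * hbb + (φ r2 + φ r5 * x 2) * hab
        + φ r6 * φ h * x 0 * hcc
    · refine ⟨r4 * (q ^ 2 + 4 * p ^ 3), r5 * (q ^ 2 + 4 * p ^ 3), r6 * (q ^ 2 + 4 * p ^ 3), r1,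
        r2, r3, ?_⟩
      simp only [map_add, map_mul, map_pow, map_ofNat, Fin.reduceFinMk]
      linear_combination (φ r4 + φ r5 * x 0 + φ r6 * x 1) * hcc

/-- In `R[A,B,C]` modulo the ideal generated by the relations (I.1)–(I.4),
every class has a representative of the form
`r1 + r2·A + r3·B + r4·C + r5·AC + r6·BC` with `r1, …, r6 ∈ R`:
higher powers of `A, B, C` can be rewritten using the ideal.
Here `A = X 0`, `B = X 1`, `C = X 2`. -/
theorem F4_quotient_six_generators (R : Type*) [CommRing R] [Invertible (2 : R)]
    (p q : R) (I : Ideal (MvPolynomial (Fin 3) R))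
    (hI : I = Ideal.span
      { (X 2)^2 - MvPolynomial.C q^2 - 4*MvPolynomial.C p^3,
        X 0 * X 1 + MvPolynomial.C p^3,
        (X 0)^2 - (MvPolynomial.C q - X 2) * X 1 * MvPolynomial.C (⅟(2 : R)),
        (X 1)^2 - (MvPolynomial.C q + X 2) * X 0 * MvPolynomial.C (⅟(2 : R)) }) :
    ∀ s : MvPolynomial (Fin 3) R ⧸ I, ∃ r1 r2 r3 r4 r5 r6 : R,
      s = Ideal.Quotient.mk I
        (MvPolynomial.C r1 + MvPolynomial.C r2 * X 0 + MvPolynomial.C r3 * X 1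
          + MvPolynomial.C r4 * X 2 + MvPolynomial.C r5 * (X 0 * X 2)
          + MvPolynomial.C r6 * (X 1 * X 2)) := by
  intro s
  obtain ⟨f, rfl⟩ := Ideal.Quotient.mk_surjective s
  have mk_C (r : R) : Ideal.Quotient.mk I (C r) = algebraMap R _ r := rfl
  have hf : Ideal.Quotient.mk I f = aeval (fun i => Ideal.Quotient.mk I (X i)) f :=
    DFunLike.congr_fun (aeval_unique (Ideal.Quotient.mkₐ R I)) f
  have hcc : Ideal.Quotient.mk I (X 2 ^ 2 - C q ^ 2 - 4 * C p ^ 3) = 0 :=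
    Ideal.Quotient.eq_zero_iff_mem.2 (hI ▸ Ideal.subset_span (by simp))
  have hab : Ideal.Quotient.mk I (X 0 * X 1 + C p ^ 3) = 0 :=
    Ideal.Quotient.eq_zero_iff_mem.2 (hI ▸ Ideal.subset_span (by simp))
  have haa : Ideal.Quotient.mk I (X 0 ^ 2 - (C q - X 2) * X 1 * C (⅟(2 : R))) = 0 :=
    Ideal.Quotient.eq_zero_iff_mem.2 (hI ▸ Ideal.subset_span (by simp))
  have hbb : Ideal.Quotient.mk I (X 1 ^ 2 - (C q + X 2) * X 0 * C (⅟(2 : R))) = 0 :=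
    Ideal.Quotient.eq_zero_iff_mem.2 (hI ▸ Ideal.subset_span (by simp))
  simp only [map_add, map_sub, map_mul, map_pow, map_ofNat, mk_C] at hcc hab haa hbb ⊢
  rw [hf]
  exact exists_aeval_eq_six_generators (p := p) (q := q) (h := ⅟2) (by linear_combination hcc)
    (by linear_combination hab) (by linear_combination haa) (by linear_combination hbb) f
end

section
/- Fix complex numbers u1, u2, u3, u4 and let P(x), Q(x) in C[x] be the polynomials p and q of the F4 curve evaluated at these values. In S = C[x, A, B, C], let J be the ideal generated by the five elements C^2 - Q^2 - 4P^3, AB + P^3, A^2 - (Q - C)B/2, B^2 - (Q + C)A/2, and D, where D = -(ABC/24)·(db1/dx) + (1/6)(-ACQ/2 - A(Q^2+4P^3)/2)(-(1/2)dQ/dx) + (1/6)(-AQ/2 - AC/2)((Q/2)dQ/dx + 3P^2 dP/dx) + (1/6)(-BCQ/2 + B(Q^2+4P^3)/2)(-(1/2)dQ/dx) + (1/6)(-BQ/2 + BC/2)(-(Q/2)dQ/dx - 3P^2 dP/dx). Then the quotient ring S/J is a finite-dimensional complex vector space. -/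
open MvPolynomial

namespace F4WDVV15

noncomputable section

/-- The polynomial ring `ℂ[x, A, B, C]` with `x = X 0`, `A = X 1`,
`B = X 2`, `C = X 3`. -/
abbrev S4 : Type := MvPolynomial (Fin 4) ℂ

def vx : S4 := X 0
def vA : S4 := X 1
def vB : S4 := X 2
def vC : S4 := X 3

/-- Constant polynomial. -/
def κ (r : ℂ) : S4 := MvPolynomial.C r

/-- The polynomial `b1` of the F4 spectral curve, at fixed `u1, u2, u3, u4`. -/
def b1 (u1 u2 u3 u4 : ℂ) : S4 :=
  -636*vx^9 - 300*(κ u1)*vx^7 - 48*(κ u1)^2*vx^5 - 5*(κ u2)*vx^3 + 2*(κ u3)*vx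

/-- The polynomial `b2` of the F4 spectral curve, at fixed `u1, u2, u3, u4`. -/
def b2 (u1 u2 u3 u4 : ℂ) : S4 :=
  -168*vx^18 - 348*(κ u1)*vx^16 - 276*(κ u1)^2*vx^14
  + (-116*(κ u1)^3 + 14*(κ u2))*vx^12
  + (-92*(κ u3) - 20*(κ u1)^4 - 8*(κ u1)*(κ u2))*vx^10
  + (-42*(κ u1)*(κ u3) - 6*(κ u1)^2*(κ u2))*vx^8
  + (-4*(κ u4) - κ (10/3)*(κ u1)^2*(κ u3) - κ (2/3)*(κ u2)^2)*vx^6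
  + (κ (1/3)*(κ u2)*(κ u3) - κ (2/3)*(κ u1)*(κ u4))*vx^4

/-- The polynomial `b3` of the F4 spectral curve, at fixed `u1, u2, u3, u4`. -/
def b3 (u1 u2 u3 u4 : ℂ) : S4 :=
  vx^27 + 6*(κ u1)*vx^25 + 15*(κ u1)^2*vx^23 + (20*(κ u1)^3 + (κ u2))*vx^21
  + (5*(κ u3) + 4*(κ u1)*(κ u2) + 15*(κ u1)^4)*vx^19
  + (6*(κ u1)^2*(κ u2) + 12*(κ u1)*(κ u3) + 6*(κ u1)^5)*vx^17
  + (κ (1/3)*(κ u2)^2 + 5*(κ u4) + 4*(κ u1)^3*(κ u2)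
      + κ (26/3)*(κ u1)^2*(κ u3) + (κ u1)^6)*vx^15
  + (κ (4/3)*(κ u1)^3*(κ u3) + κ (19/3)*(κ u1)*(κ u4) + (κ u1)^4*(κ u2)
      + κ (4/3)*(κ u2)*(κ u3) + κ (2/3)*(κ u1)*(κ u2)^2)*vx^13
  + (κ (1/3)*(κ u1)^2*(κ u2)^2 - κ (1/3)*(κ u1)^4*(κ u3)
      - κ (15/4)*(κ u3)^2 + 3*(κ u1)^2*(κ u4))*vx^11
  + (κ (1/3)*(κ u2)*(κ u4) - κ (4/9)*(κ u1)^2*(κ u2)*(κ u3)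
      + κ (1/27)*(κ u2)^3 - κ (13/6)*(κ u1)*(κ u3)^2
      + κ (13/27)*(κ u1)^3*(κ u4))*vx^9
  + (-(κ (1/9)*(κ u2)^2*(κ u3)) - κ (1/2)*(κ u3)*(κ u4)
      + κ (1/9)*(κ u1)*(κ u2)*(κ u4) - κ (7/36)*(κ u1)^2*(κ u3)^2)*vx^7
  + (κ (1/12)*(κ u2)*(κ u3)^2 - κ (1/6)*(κ u1)*(κ u3)*(κ u4))*vx^5
  + (-(κ (1/54)*(κ u3)^3) - κ (1/108)*(κ u4)^2)*vx^3

/-- The polynomial `P = -b2/6 - b1²/144`. -/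
def P (u1 u2 u3 u4 : ℂ) : S4 :=
  -(κ (1/6)*b2 u1 u2 u3 u4) - κ (1/144)*(b1 u1 u2 u3 u4)^2

/-- The polynomial `Q = (1/27)(b1³/32 + (9/8)b1·b2 + 27·b3)`. -/
def Q (u1 u2 u3 u4 : ℂ) : S4 :=
  κ (1/27)*(κ (1/32)*(b1 u1 u2 u3 u4)^3
    + κ (9/8)*(b1 u1 u2 u3 u4)*(b2 u1 u2 u3 u4) + 27*(b3 u1 u2 u3 u4))

/-- The polynomial `D` representing `abc·∂W/∂x` (up to sign), via the formula
of Proposition 1 of the paper, with `d/dx` the formal derivative `pderiv 0`. -/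
def D (u1 u2 u3 u4 : ℂ) : S4 :=
  -(κ (1/24)*vA*vB*vC*(pderiv 0 (b1 u1 u2 u3 u4)))
  + κ (1/6)*(-(κ (1/2)*vA*vC*(Q u1 u2 u3 u4))
      - κ (1/2)*vA*((Q u1 u2 u3 u4)^2 + 4*(P u1 u2 u3 u4)^3))
      *(-(κ (1/2)*(pderiv 0 (Q u1 u2 u3 u4))))
  + κ (1/6)*(-(κ (1/2)*vA*(Q u1 u2 u3 u4)) - κ (1/2)*vA*vC)
      *(κ (1/2)*(Q u1 u2 u3 u4)*(pderiv 0 (Q u1 u2 u3 u4))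
        + 3*(P u1 u2 u3 u4)^2*(pderiv 0 (P u1 u2 u3 u4)))
  + κ (1/6)*(-(κ (1/2)*vB*vC*(Q u1 u2 u3 u4))
      + κ (1/2)*vB*((Q u1 u2 u3 u4)^2 + 4*(P u1 u2 u3 u4)^3))
      *(-(κ (1/2)*(pderiv 0 (Q u1 u2 u3 u4))))
  + κ (1/6)*(-(κ (1/2)*vB*(Q u1 u2 u3 u4)) + κ (1/2)*vB*vC)
      *(-(κ (1/2)*(Q u1 u2 u3 u4)*(pderiv 0 (Q u1 u2 u3 u4)))
        - 3*(P u1 u2 u3 u4)^2*(pderiv 0 (P u1 u2 u3 u4)))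

/-- The ideal `J` generated by the relations (I.1)–(I.4) together with `D`. -/
def J (u1 u2 u3 u4 : ℂ) : Ideal S4 := Ideal.span
  { vC^2 - (Q u1 u2 u3 u4)^2 - 4*(P u1 u2 u3 u4)^3,
    vA*vB + (P u1 u2 u3 u4)^3,
    vA^2 - ((Q u1 u2 u3 u4) - vC)*vB*κ (1/2),
    vB^2 - ((Q u1 u2 u3 u4) + vC)*vA*κ (1/2),
    D u1 u2 u3 u4 }

/-- The resultant of `r Y² + s Y + t` and `Y³ + m Y + n`. -/
def eliminant {T : Type*} [CommRing T] (r s t m n : T) : T :=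
  t * ((t - r * m) ^ 2 + s * (r * n + s * m)) + r * n * (s * t + r ^ 2 * n)
    - s * n * (s ^ 2 - r * (t - r * m))

/-- The cofactor expressing `eliminant` as a multiple of `r Y² + s Y + t` modulo `Y³ + m Y + n`. -/
def eliminantCofactor {T : Type*} [CommRing T] (r s t m n y : T) : T :=
  (t - r * m) ^ 2 + s * (r * n + s * m) - (s * t + r ^ 2 * n) * y
    + (s ^ 2 - r * (t - r * m)) * y ^ 2

theorem eliminant_mul_eq {T : Type*} [CommRing T] (r s t : T) {m n y : T}
    (hy : y ^ 3 + m * y + n = 0) :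
    eliminant r s t m n = (r * y ^ 2 + s * y + t) * eliminantCofactor r s t m n y := by
  unfold eliminant eliminantCofactor
  linear_combination (-(r * (s ^ 2 - r * (t - r * m)) * y) - s * (s ^ 2 - r * (t - r * m))
    + r * (s * t + r ^ 2 * n)) * hy

/-- A relation in the base polynomial ring implied by the vanishing of `D` on the curve. -/
theorem elimination {T : Type*} [CommRing T] {a b c p q p' q' β h₂ h₆ h₂₄ : T}
    (hh₂ : h₂ * 2 = 1) (hh₆ : h₆ * 6 = 1) (hh₂₄ : h₂₄ * 24 = 1)
    (hc : c ^ 2 - q ^ 2 - 4 * p ^ 3 = 0) (hab : a * b + p ^ 3 = 0)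
    (ha : a ^ 2 - (q - c) * b * h₂ = 0) (hb : b ^ 2 - (q + c) * a * h₂ = 0)
    (hD : -(h₂₄ * a * b * c * β)
      + h₆ * (-(h₂ * a * c * q) - h₂ * a * (q ^ 2 + 4 * p ^ 3)) * (-(h₂ * q'))
      + h₆ * (-(h₂ * a * q) - h₂ * a * c) * (h₂ * q * q' + 3 * p ^ 2 * p')
      + h₆ * (-(h₂ * b * c * q) + h₂ * b * (q ^ 2 + 4 * p ^ 3)) * (-(h₂ * q'))
      + h₆ * (-(h₂ * b * q) + h₂ * b * c) * (-(h₂ * q * q') - 3 * p ^ 2 * p') = 0) :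
    (q ^ 2 + 4 * p ^ 3) * p ^ 3 *
      eliminant β (12 * p ^ 2 * p') (p ^ 3 * β + 4 * p ^ 3 * q') (3 * p ^ 3) (q * p ^ 3) = 0 := by
  have hA : 2 * a ^ 2 = (q - c) * b := by linear_combination 2 * ha + (q - c) * b * hh₂
  have hB : 2 * b ^ 2 = (q + c) * a := by linear_combination 2 * hb + (q + c) * a * hh₂
  have hD' : p ^ 2 * (p * c * β + 2 * (2 * p * q' - 3 * p' * q) * (a - b)
      - 6 * p' * c * (a + b)) = 0 := by
    have h₁ : -(a * b * c * β) + (a * c * q + a * (q ^ 2 + 4 * p ^ 3)) * q'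
        - (a * q + a * c) * (q * q' + 6 * p ^ 2 * p')
        + (b * c * q - b * (q ^ 2 + 4 * p ^ 3)) * q'
        + (b * q - b * c) * (q * q' + 6 * p ^ 2 * p') = 0 := by
      have h₃ : (3 : T) = 6 * h₂ := by linear_combination -3 * hh₂
      have h₄ : 24 * (h₆ * h₂ * h₂) = 1 := by
        linear_combination (2 * h₂ * hh₆ * 2 * h₂) + (2 * h₂ + 1) * hh₂
      rw [h₃] at hD
      linear_combination 24 * hD + (a * b * c * β) * hh₂₄ -
        ((a * c * q + a * (q ^ 2 + 4 * p ^ 3)) * q'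
        - (a * q + a * c) * (q * q' + 6 * p ^ 2 * p')
        + (b * c * q - b * (q ^ 2 + 4 * p ^ 3)) * q'
        + (b * q - b * c) * (q * q' + 6 * p ^ 2 * p')) * h₄
    linear_combination h₁ + c * β * hab
  have hcube : (a + b) ^ 3 + 3 * p ^ 3 * (a + b) + q * p ^ 3 = 0 := by
    linear_combination (h₂ * a) * hA + h₂ * b * hB + (q + 3 * (a + b)) * hab
      + (q * a * b - a ^ 3 - b ^ 3) * hh₂
  have hdiff : (a - b) * ((a + b) ^ 2 + p ^ 3) = c * p ^ 3 := by
    linear_combination (h₂ * a) * hA - h₂ * b * hB + (a - b - c) * hab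
      - (c * a * b + a ^ 3 - b ^ 3) * hh₂
  have hK : c * p ^ 3 * (β * (a + b) ^ 2 + 12 * p ^ 2 * p' * (a + b)
      + (p ^ 3 * β + 4 * p ^ 3 * q')) = 0 := by
    linear_combination ((a + b) ^ 2 + p ^ 3) * hD'
      - 2 * p ^ 2 * (2 * p * q' - 3 * p' * q) * hdiff + 6 * p' * c * p ^ 2 * hcube
  have hE := eliminant_mul_eq β (12 * p ^ 2 * p') (p ^ 3 * β + 4 * p ^ 3 * q') hcube
  rw [hE]
  linear_combination (c * eliminantCofactor β (12 * p ^ 2 * p') (p ^ 3 * β + 4 * p ^ 3 * q')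
      (3 * p ^ 3) (q * p ^ 3) (a + b)) * hK
    - p ^ 3 * (β * (a + b) ^ 2 + 12 * p ^ 2 * p' * (a + b)
      + (p ^ 3 * β + 4 * p ^ 3 * q')) * eliminantCofactor β (12 * p ^ 2 * p')
      (p ^ 3 * β + 4 * p ^ 3 * q') (3 * p ^ 3) (q * p ^ 3) (a + b) * hc

open Polynomial in
/-- The polynomial `f` has degree at most `n`, and its coefficient of degree `n` is `r`. -/
def HasTop (f : ℂ[X]) (n : ℕ) (r : ℂ) : Prop := f.natDegree ≤ n ∧ f.coeff n = r

namespace HasTop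

open Polynomial

variable {f g : ℂ[X]} {n m : ℕ} {r s : ℂ}

theorem add (hf : HasTop f n r) (hg : HasTop g n s) : HasTop (f + g) n (r + s) :=
  ⟨natDegree_add_le_of_degree_le hf.1 hg.1, by rw [Polynomial.coeff_add, hf.2, hg.2]⟩

theorem sub (hf : HasTop f n r) (hg : HasTop g n s) : HasTop (f - g) n (r - s) :=
  ⟨natDegree_sub_le_of_le hf.1 hg.1 |>.trans (max_self n).le,
      by rw [Polynomial.coeff_sub, hf.2, hg.2]⟩

theorem mul (hf : HasTop f n r) (hg : HasTop g m s) : HasTop (f * g) (n + m) (r * s) :=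
  ⟨natDegree_mul_le_of_le hf.1 hg.1, by
    rw [coeff_mul_add_eq_of_natDegree_le hf.1 hg.1, hf.2, hg.2]⟩

theorem pow (hf : HasTop f n r) (k : ℕ) : HasTop (f ^ k) (k * n) (r ^ k) :=
  ⟨natDegree_pow_le_of_le k hf.1, by rw [coeff_pow_of_natDegree_le hf.1, hf.2]⟩

theorem const (r : ℂ) : HasTop (Polynomial.C r) 0 r := ⟨by simp, by simp⟩

theorem ofNat (k : ℕ) [k.AtLeastTwo] : HasTop (OfNat.ofNat k : ℂ[X]) 0 (OfNat.ofNat k) :=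
  map_ofNat (Polynomial.C : ℂ →+* ℂ[X]) k ▸ const (OfNat.ofNat k)

theorem derivative (hf : HasTop f (n + 1) r) :
    HasTop (Polynomial.derivative f) n (r * (n + 1)) :=
  ⟨(natDegree_derivative_le f).trans (Nat.sub_le_of_le_add hf.1), by
    rw [coeff_derivative, hf.2]⟩

theorem of_lt (hf : HasTop f n r) (h : n < m) : HasTop f m 0 :=
  ⟨le_trans hf.1 h.le, coeff_eq_zero_of_natDegree_lt (lt_of_le_of_lt hf.1 h)⟩

theorem ne_zero (hf : HasTop f n r) (hr : r ≠ 0) : f ≠ 0 := by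
  rintro rfl
  exact hr (by simpa using hf.2.symm)

end HasTop

/-- The univariate polynomial underlying `b1`. -/
def b1Poly (u1 u2 u3 _u4 : ℂ) : Polynomial ℂ :=
  -636*Polynomial.X^9 - 300*Polynomial.C u1*Polynomial.X^7 - 48*Polynomial.C u1^2*Polynomial.X^5
      - 5*Polynomial.C u2*Polynomial.X^3 + 2*Polynomial.C u3*Polynomial.X

/-- The univariate polynomial underlying `b2`. -/
def b2Poly (u1 u2 u3 u4 : ℂ) : Polynomial ℂ :=
  -168*Polynomial.X^18 - 348*Polynomial.C u1*Polynomial.X^16 - 276*Polynomial.C u1^2*Polynomial.X^14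
  + (-116*Polynomial.C u1^3 + 14*Polynomial.C u2)*Polynomial.X^12
  + (-92*Polynomial.C u3 - 20*Polynomial.C u1^4 - 8*Polynomial.C u1*Polynomial.C u2)*Polynomial.X^10
  + (-42*Polynomial.C u1*Polynomial.C u3 - 6*Polynomial.C u1^2*Polynomial.C u2)*Polynomial.X^8
  + (-4*Polynomial.C u4 - Polynomial.C (10/3)*Polynomial.C u1^2*Polynomial.C u3
      - Polynomial.C (2/3)*Polynomial.C u2^2)*Polynomial.X^6
  + (Polynomial.C (1/3)*Polynomial.C u2*Polynomial.C u3
      - Polynomial.C (2/3)*Polynomial.C u1*Polynomial.C u4)*Polynomial.X^4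

/-- The univariate polynomial underlying `b3`. -/
def b3Poly (u1 u2 u3 u4 : ℂ) : Polynomial ℂ :=
  Polynomial.X^27 + 6*Polynomial.C u1*Polynomial.X^25 + 15*Polynomial.C u1^2*Polynomial.X^23
      + (20*Polynomial.C u1^3 + Polynomial.C u2)*Polynomial.X^21
  + (5*Polynomial.C u3 + 4*Polynomial.C u1*Polynomial.C u2 + 15*Polynomial.C u1^4)*Polynomial.X^19
  + (6*Polynomial.C u1^2*Polynomial.C u2 + 12*Polynomial.C u1*Polynomial.C u3
      + 6*Polynomial.C u1^5)*Polynomial.X^17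
  + (Polynomial.C (1/3)*Polynomial.C u2^2 + 5*Polynomial.C u4 + 4*Polynomial.C u1^3*Polynomial.C u2
      + Polynomial.C (26/3)*Polynomial.C u1^2*Polynomial.C u3 + Polynomial.C u1^6)*Polynomial.X^15
  + (Polynomial.C (4/3)*Polynomial.C u1^3*Polynomial.C u3
      + Polynomial.C (19/3)*Polynomial.C u1*Polynomial.C u4 + Polynomial.C u1^4*Polynomial.C u2
      + Polynomial.C (4/3)*Polynomial.C u2*Polynomial.C u3
          + Polynomial.C (2/3)*Polynomial.C u1*Polynomial.C u2^2)*Polynomial.X^13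
  + (Polynomial.C (1/3)*Polynomial.C u1^2*Polynomial.C u2^2
      - Polynomial.C (1/3)*Polynomial.C u1^4*Polynomial.C u3
      - Polynomial.C (15/4)*Polynomial.C u3^2 + 3*Polynomial.C u1^2*Polynomial.C u4)*Polynomial.X^11
  + (Polynomial.C (1/3)*Polynomial.C u2*Polynomial.C u4
      - Polynomial.C (4/9)*Polynomial.C u1^2*Polynomial.C u2*Polynomial.C u3
      + Polynomial.C (1/27)*Polynomial.C u2^3
          - Polynomial.C (13/6)*Polynomial.C u1*Polynomial.C u3^2
      + Polynomial.C (13/27)*Polynomial.C u1^3*Polynomial.C u4)*Polynomial.X^9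
  + (-(Polynomial.C (1/9)*Polynomial.C u2^2*Polynomial.C u3)
      - Polynomial.C (1/2)*Polynomial.C u3*Polynomial.C u4
      + Polynomial.C (1/9)*Polynomial.C u1*Polynomial.C u2*Polynomial.C u4
          - Polynomial.C (7/36)*Polynomial.C u1^2*Polynomial.C u3^2)*Polynomial.X^7
  + (Polynomial.C (1/12)*Polynomial.C u2*Polynomial.C u3^2
      - Polynomial.C (1/6)*Polynomial.C u1*Polynomial.C u3*Polynomial.C u4)*Polynomial.X^5
  + (-(Polynomial.C (1/54)*Polynomial.C u3^3)
      - Polynomial.C (1/108)*Polynomial.C u4^2)*Polynomial.X^3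

/-- The univariate polynomial underlying `P`. -/
def PPoly (u1 u2 u3 u4 : ℂ) : Polynomial ℂ :=
  -(Polynomial.C (1/6)*b2Poly u1 u2 u3 u4) - Polynomial.C (1/144)*(b1Poly u1 u2 u3 u4)^2

/-- The univariate polynomial underlying `Q`. -/
def QPoly (u1 u2 u3 u4 : ℂ) : Polynomial ℂ :=
  Polynomial.C (1/27)*(Polynomial.C (1/32)*(b1Poly u1 u2 u3 u4)^3
    + Polynomial.C (9/8)*(b1Poly u1 u2 u3 u4)*(b2Poly u1 u2 u3 u4) + 27*(b3Poly u1 u2 u3 u4))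

theorem aeval_b1 (u1 u2 u3 u4 : ℂ) :
    Polynomial.aeval vx (b1Poly u1 u2 u3 u4) = b1 u1 u2 u3 u4 := by
  simp [b1Poly, b1, κ, MvPolynomial.algebraMap_eq, map_ofNat (Polynomial.aeval vx)]

theorem aeval_b2 (u1 u2 u3 u4 : ℂ) :
    Polynomial.aeval vx (b2Poly u1 u2 u3 u4) = b2 u1 u2 u3 u4 := by
  simp [b2Poly, b2, κ, MvPolynomial.algebraMap_eq, map_ofNat (Polynomial.aeval vx)]

theorem aeval_b3 (u1 u2 u3 u4 : ℂ) :
    Polynomial.aeval vx (b3Poly u1 u2 u3 u4) = b3 u1 u2 u3 u4 := by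
  simp [b3Poly, b3, κ, MvPolynomial.algebraMap_eq, map_ofNat (Polynomial.aeval vx)]

theorem aeval_P (u1 u2 u3 u4 : ℂ) :
    Polynomial.aeval vx (PPoly u1 u2 u3 u4) = P u1 u2 u3 u4 := by
  simp [PPoly, P, κ, MvPolynomial.algebraMap_eq, aeval_b1, aeval_b2]

theorem aeval_Q (u1 u2 u3 u4 : ℂ) :
    Polynomial.aeval vx (QPoly u1 u2 u3 u4) = Q u1 u2 u3 u4 := by
  simp [QPoly, Q, κ, MvPolynomial.algebraMap_eq, map_ofNat (Polynomial.aeval vx), aeval_b1,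
      aeval_b2, aeval_b3]

theorem hasTop_b1 (u1 u2 u3 u4 : ℂ) : HasTop (b1Poly u1 u2 u3 u4) 9 (-636) := by
  unfold b1Poly
  simp only [HasTop, ← Polynomial.C_pow, ← Polynomial.C_mul, ← Polynomial.C_neg,
      ← map_ofNat Polynomial.C]
  constructor
  · compute_degree
  · compute_degree!

theorem hasTop_b2 (u1 u2 u3 u4 : ℂ) : HasTop (b2Poly u1 u2 u3 u4) 18 (-168) := by
  unfold b2Poly
  simp only [HasTop, ← Polynomial.C_pow, ← Polynomial.C_mul, ← Polynomial.C_add,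
      ← Polynomial.C_sub, ← Polynomial.C_neg, ← map_ofNat Polynomial.C]
  constructor
  · compute_degree
  · compute_degree!

theorem hasTop_b3 (u1 u2 u3 u4 : ℂ) : HasTop (b3Poly u1 u2 u3 u4) 27 1 := by
  unfold b3Poly
  simp only [HasTop, ← Polynomial.C_pow, ← Polynomial.C_mul, ← Polynomial.C_add,
      ← Polynomial.C_sub, ← Polynomial.C_neg, ← map_ofNat Polynomial.C]
  constructor
  · compute_degree
  · compute_degree!

theorem hasTop_P (u1 u2 u3 u4 : ℂ) : HasTop (PPoly u1 u2 u3 u4) 18 (-2781) := by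
  have h := (((HasTop.const (-1 / 6)).mul (hasTop_b2 u1 u2 u3 u4))).sub
    ((HasTop.const (1 / 144)).mul ((hasTop_b1 u1 u2 u3 u4).pow 2))
  convert h using 1
  · simp only [PPoly, neg_div, Polynomial.C_neg]
    ring
  · norm_num

theorem hasTop_Q (u1 u2 u3 u4 : ℂ) : HasTop (QPoly u1 u2 u3 u4) 27 (-293301) := by
  have h₁ := hasTop_b1 u1 u2 u3 u4
  have h := (HasTop.const (1 / 27)).mul (((((HasTop.const (1 / 32)).mul (h₁.pow 3))).add
    (((HasTop.const (9 / 8)).mul h₁).mul (hasTop_b2 u1 u2 u3 u4))).add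
    ((HasTop.ofNat (nat_lit 27)).mul (hasTop_b3 u1 u2 u3 u4)))
  unfold QPoly
  convert h using 1
  norm_num

/-- A polynomial in `x` contained in the ideal `J`. -/
def xRelation (u1 u2 u3 u4 : ℂ) : Polynomial ℂ :=
  let p := PPoly u1 u2 u3 u4
  let q := QPoly u1 u2 u3 u4
  let β := Polynomial.derivative (b1Poly u1 u2 u3 u4)
  (q ^ 2 + 4 * p ^ 3) * p ^ 3 *
    eliminant β (12 * p ^ 2 * Polynomial.derivative p)
      (p ^ 3 * β + 4 * p ^ 3 * Polynomial.derivative q) (3 * p ^ 3) (q * p ^ 3)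

theorem hasTop_eliminant {r s t m n : Polynomial ℂ} {s₀ t₀ m₀ n₀ : ℂ}
    (hr : HasTop r 25 0) (hs : HasTop s 53 s₀) (ht : HasTop t 80 t₀)
    (hm : HasTop m 54 m₀) (hn : HasTop n 81 n₀) :
    HasTop (eliminant r s t m n) 240 (t₀ ^ 3 + t₀ * s₀ ^ 2 * m₀ - s₀ ^ 3 * n₀) := by
  have hrm : HasTop (r * m) 80 0 := (hr.mul hm).of_lt (by norm_num)
  have hrn : HasTop (r * n) 107 0 := (hr.mul hn).of_lt (by norm_num)
  have hrrn : HasTop (r ^ 2 * n) 133 0 := ((hr.pow 2).mul hn).of_lt (by norm_num)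
  have hd := ht.sub hrm
  have hrd : HasTop (r * (t - r * m)) 106 0 := (hr.mul hd).of_lt (by norm_num)
  have h := ((ht.mul ((hd.pow 2).add (hs.mul (hrn.add (hs.mul hm))))).add
    (hrn.mul ((hs.mul ht).add hrrn))).sub ((hs.mul hn).mul ((hs.pow 2).sub hrd))
  unfold eliminant
  convert h using 1
  ring

theorem xRelation_ne_zero (u1 u2 u3 u4 : ℂ) : xRelation u1 u2 u3 u4 ≠ 0 := by
  have hp := hasTop_P u1 u2 u3 u4
  have hq := hasTop_Q u1 u2 u3 u4
  have hβ := (hasTop_b1 u1 u2 u3 u4).derivative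
  have hp3 := hp.pow 3
  have h := (((hq.pow 2).add ((HasTop.ofNat (nat_lit 4)).mul hp3)).mul hp3).mul (hasTop_eliminant
    (hβ.of_lt (by norm_num)) (((HasTop.ofNat (nat_lit 12)).mul (hp.pow 2)).mul hp.derivative)
    (((hp3.mul hβ).of_lt (by norm_num)).add (((HasTop.ofNat (nat_lit 4)).mul hp3).mul hq.derivative))
    ((HasTop.ofNat (nat_lit 3)).mul hp3) (hq.mul hp3))
  exact h.ne_zero (by norm_num)

theorem pderiv_aeval_vx (f : Polynomial ℂ) :
    pderiv 0 (Polynomial.aeval vx f) = Polynomial.aeval vx (Polynomial.derivative f) := by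
  rw [Derivation.map_aeval, vx, pderiv_X_self, smul_eq_mul, mul_one]

/-- The quotient map onto the coordinate ring of `J`. -/
def quotientMap (u1 u2 u3 u4 : ℂ) : S4 →ₐ[ℂ] S4 ⧸ J u1 u2 u3 u4 :=
  Ideal.Quotient.mkₐ ℂ (J u1 u2 u3 u4)

theorem quotientMap_eq_zero {u1 u2 u3 u4 : ℂ} {f : S4} (hf : f ∈ J u1 u2 u3 u4) :
    quotientMap u1 u2 u3 u4 f = 0 :=
  Ideal.Quotient.eq_zero_iff_mem.mpr hf

theorem aeval_quotientMap_vx (u1 u2 u3 u4 : ℂ) (f : Polynomial ℂ) :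
    Polynomial.aeval (quotientMap u1 u2 u3 u4 vx) f =
      quotientMap u1 u2 u3 u4 (Polynomial.aeval vx f) :=
  Polynomial.aeval_algHom_apply _ _ _

theorem aeval_xRelation (u1 u2 u3 u4 : ℂ) :
    Polynomial.aeval (quotientMap u1 u2 u3 u4 vx) (xRelation u1 u2 u3 u4) = 0 := by
  have hC : vC ^ 2 - Q u1 u2 u3 u4 ^ 2 - 4 * P u1 u2 u3 u4 ^ 3 ∈ J u1 u2 u3 u4 :=
    Ideal.subset_span (by simp)
  have hAB : vA * vB + P u1 u2 u3 u4 ^ 3 ∈ J u1 u2 u3 u4 := Ideal.subset_span (by simp)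
  have hA : vA ^ 2 - (Q u1 u2 u3 u4 - vC) * vB * κ (1 / 2) ∈ J u1 u2 u3 u4 :=
    Ideal.subset_span (by simp)
  have hB : vB ^ 2 - (Q u1 u2 u3 u4 + vC) * vA * κ (1 / 2) ∈ J u1 u2 u3 u4 :=
    Ideal.subset_span (by simp)
  have hD : D u1 u2 u3 u4 ∈ J u1 u2 u3 u4 := Ideal.subset_span (by simp)
  have hκ (k : ℕ) [k.AtLeastTwo] :
      quotientMap u1 u2 u3 u4 (κ (1 / OfNat.ofNat k)) * OfNat.ofNat k = 1 := by
    rw [← map_ofNat (quotientMap u1 u2 u3 u4) k, ← map_mul, κ, ← map_ofNat MvPolynomial.C k,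
      ← map_mul, one_div_mul_cancel (OfNat.ofNat_ne_zero k), map_one, map_one]
  have hD₀ := quotientMap_eq_zero hD
  rw [D, ← aeval_b1, ← aeval_P, ← aeval_Q] at hD₀
  simp only [pderiv_aeval_vx] at hD₀
  rw [aeval_P, aeval_Q] at hD₀
  have hrel := elimination (hκ (nat_lit 2)) (hκ (nat_lit 6)) (hκ (nat_lit 24))
    (by simpa only [map_sub, map_mul, map_pow, map_ofNat] using quotientMap_eq_zero hC)
    (by simpa only [map_add, map_mul, map_pow] using quotientMap_eq_zero hAB)
    (by simpa only [map_sub, map_mul, map_pow] using quotientMap_eq_zero hA)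
    (by simpa only [map_sub, map_add, map_mul, map_pow] using quotientMap_eq_zero hB)
    (by simpa only [map_sub, map_add, map_neg, map_mul, map_pow, map_ofNat] using hD₀)
  simp only [aeval_quotientMap_vx, xRelation]
  rw [← aeval_P, ← aeval_Q] at hrel
  simpa only [map_add, map_mul, map_pow, map_ofNat, eliminant, map_sub] using hrel

theorem isIntegral_quotientMap_X (u1 u2 u3 u4 : ℂ) (i : Fin 4) :
    IsIntegral ℂ (quotientMap u1 u2 u3 u4 (X i)) := by
  have hx : IsIntegral ℂ (quotientMap u1 u2 u3 u4 vx) :=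
    isAlgebraic_iff_isIntegral.mp
      ⟨_, xRelation_ne_zero u1 u2 u3 u4, aeval_xRelation u1 u2 u3 u4⟩
  have hpoly (f : Polynomial ℂ) :
      IsIntegral ℂ (quotientMap u1 u2 u3 u4 (Polynomial.aeval vx f)) := by
    rw [← aeval_quotientMap_vx]
    exact IsIntegral.of_mem_of_fg _ hx.fg_adjoin_singleton _
        (Polynomial.aeval_mem_adjoin_singleton ℂ _)
  have hP := hpoly (PPoly u1 u2 u3 u4)
  have hQ := hpoly (QPoly u1 u2 u3 u4)
  rw [aeval_P] at hP
  rw [aeval_Q] at hQ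
  have hκ (r : ℂ) : IsIntegral ℂ (quotientMap u1 u2 u3 u4 (κ r)) :=
    (isIntegral_algebraMap (x := r)).map (quotientMap u1 u2 u3 u4)
  have hC : IsIntegral ℂ (quotientMap u1 u2 u3 u4 vC) := by
    have h : quotientMap u1 u2 u3 u4 (vC ^ 2 - Q u1 u2 u3 u4 ^ 2 - 4 * P u1 u2 u3 u4 ^ 3) = 0 :=
      quotientMap_eq_zero (Ideal.subset_span (by simp))
    refine IsIntegral.of_pow (n := 2) (by norm_num) ?_
    have h' : quotientMap u1 u2 u3 u4 vC ^ 2 = quotientMap u1 u2 u3 u4 (Q u1 u2 u3 u4) ^ 2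
        + quotientMap u1 u2 u3 u4 (κ 4) * quotientMap u1 u2 u3 u4 (P u1 u2 u3 u4) ^ 3 := by
      simp only [map_sub, map_mul, map_pow, map_ofNat, κ] at h ⊢
      linear_combination h
    rw [h']
    exact (hQ.pow 2).add ((hκ 4).mul (hP.pow 3))
  have hAB : quotientMap u1 u2 u3 u4 (vA * vB + P u1 u2 u3 u4 ^ 3) = 0 :=
    quotientMap_eq_zero (Ideal.subset_span (by simp))
  have hA : IsIntegral ℂ (quotientMap u1 u2 u3 u4 vA) := by
    have h : quotientMap u1 u2 u3 u4
        (vA ^ 2 - (Q u1 u2 u3 u4 - vC) * vB * κ (1 / 2)) = 0 :=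
      quotientMap_eq_zero (Ideal.subset_span (by simp))
    refine IsIntegral.of_pow (n := 3) (by norm_num) ?_
    have h' : quotientMap u1 u2 u3 u4 vA ^ 3 =
        -((quotientMap u1 u2 u3 u4 (Q u1 u2 u3 u4) - quotientMap u1 u2 u3 u4 vC)
          * quotientMap u1 u2 u3 u4 (κ (1 / 2)) * quotientMap u1 u2 u3 u4 (P u1 u2 u3 u4) ^ 3) := by
      simp only [map_sub, map_add, map_mul, map_pow] at h hAB
      linear_combination quotientMap u1 u2 u3 u4 vA * h +
        (quotientMap u1 u2 u3 u4 (Q u1 u2 u3 u4) - quotientMap u1 u2 u3 u4 vC)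
          * quotientMap u1 u2 u3 u4 (κ (1 / 2)) * hAB
    rw [h']
    exact (((hQ.sub hC).mul (hκ _)).mul (hP.pow 3)).neg
  have hB : IsIntegral ℂ (quotientMap u1 u2 u3 u4 vB) := by
    have h : quotientMap u1 u2 u3 u4
        (vB ^ 2 - (Q u1 u2 u3 u4 + vC) * vA * κ (1 / 2)) = 0 :=
      quotientMap_eq_zero (Ideal.subset_span (by simp))
    refine IsIntegral.of_pow (n := 2) (by norm_num) ?_
    have h' : quotientMap u1 u2 u3 u4 vB ^ 2 =
        (quotientMap u1 u2 u3 u4 (Q u1 u2 u3 u4) + quotientMap u1 u2 u3 u4 vC)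
          * quotientMap u1 u2 u3 u4 vA * quotientMap u1 u2 u3 u4 (κ (1 / 2)) := by
      simpa only [map_sub, map_add, map_mul, map_pow, sub_eq_zero] using h
    rw [h']
    exact ((hQ.add hC).mul hA).mul (hκ _)
  fin_cases i
  exacts [hx, hA, hB, hC]

/-- The quotient `ℂ[x,A,B,C]/J` is a finite-dimensional complex vector space. -/
theorem F4_quotient_finite_dimensional (u1 u2 u3 u4 : ℂ) :
    FiniteDimensional ℂ (S4 ⧸ J u1 u2 u3 u4) := by
  have hsurj : Function.Surjective (quotientMap u1 u2 u3 u4) :=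
    Ideal.Quotient.mkₐ_surjective ℂ _
  have : Algebra.IsIntegral ℂ (S4 ⧸ J u1 u2 u3 u4) := ⟨fun y => by
    obtain ⟨f, rfl⟩ := hsurj y
    induction f using MvPolynomial.induction_on with
    | C r => exact (isIntegral_algebraMap (x := r)).map (quotientMap u1 u2 u3 u4)
    | add f g hf hg => rw [map_add]; exact hf.add hg
    | mul_X f i hf => rw [map_mul]; exact hf.mul (isIntegral_quotientMap_X u1 u2 u3 u4 i)⟩
  have : Algebra.FiniteType ℂ (S4 ⧸ J u1 u2 u3 u4) := .of_surjective _ hsurj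
  exact Algebra.IsIntegral.finite

end

end F4WDVV15
end
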